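/- arXiv:2210.09751 — 2 statements merged into one kernel-verified Lean document; each statement's English description precedes it below -/
import Mathlib

section
/- Let f : S¹ → S¹ be a homeomorphism of the circle whose set of non-wandering points is finite (and nonempty). Then the polynomial entropy of the induced map C(f) on the hyperspace C(S¹) of subcontinua of the circle equals 2. -/
open Filter Topology TopologicalSpace Set
open scoped ENNReal

/-- The dynamic distance `d_n^f(x,y) = max_{0 ≤ k ≤ n-1} d(f^k x, f^k y)`. -/
noncomputable def dynDist {X : Type*} [MetricSpace X] (f : X → X) (n : ℕ) (x y : X) : ℝ :=
  ((Finset.range n).sup fun k => nndist (f^[k] x) (f^[k] y) : NNReal)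

/-- A finite set `E` is `(n,ε)`-separated for `f`. -/
def IsDynSeparated {X : Type*} [MetricSpace X] (f : X → X) (n : ℕ) (ε : ℝ) (E : Finset X) :
    Prop :=
  ∀ x ∈ E, ∀ y ∈ E, x ≠ y → ε ≤ dynDist f n x y

/-- `S(n,ε;Y)`: the maximal cardinality of an `(n,ε)`-separated subset of `Y`. -/
noncomputable def maxSep {X : Type*} [MetricSpace X] (f : X → X) (Y : Set X) (n : ℕ) (ε : ℝ) :
    ℕ :=
  sSup {m : ℕ | ∃ E : Finset X, ↑E ⊆ Y ∧ E.card = m ∧ IsDynSeparated f n ε E}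

/-- The polynomial entropy `h_pol(f;Y)`.  Since `ε ↦ S(n,ε;Y)` is nonincreasing, the limit as
`ε → 0` of the `limsup` coincides with the supremum over `ε > 0`. -/
noncomputable def polEnt {X : Type*} [MetricSpace X] (f : X → X) (Y : Set X) : ℝ≥0∞ :=
  ⨆ (ε : ℝ) (_ : 0 < ε),
    Filter.atTop.limsup fun n : ℕ =>
      ENNReal.ofReal (Real.log (maxSep f Y n ε) / Real.log n)

/-- The set of non-wandering points of `f`. -/
def nonWandering {X : Type*} [TopologicalSpace X] (f : X → X) : Set X :=
  {p | ∀ U ∈ nhds p, ∃ n : ℕ, 1 ≤ n ∧ (f^[n] '' U ∩ U).Nonempty}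

/-- The induced map `2^f` on the hyperspace of nonempty closed (= compact) subsets of a
compact metric space. -/
noncomputable def induced2 {X : Type*} [TopologicalSpace X] (f : X → X) (hf : Continuous f) :
    NonemptyCompacts X → NonemptyCompacts X :=
  fun A => ⟨⟨f '' A, A.isCompact.image hf⟩, A.nonempty.image f⟩

/-- The hyperspace `C(X)` of subcontinua (nonempty closed connected subsets) of `X`. -/
abbrev Subcontinua (X : Type*) [TopologicalSpace X] :=
  {A : NonemptyCompacts X // IsConnected (A : Set X)}

/-- The induced map `C(f)` on the hyperspace of subcontinua. -/
noncomputable def inducedC {X : Type*} [TopologicalSpace X] (f : X → X) (hf : Continuous f) :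
    Subcontinua X → Subcontinua X :=
  fun A => ⟨induced2 f hf A.1, A.2.image f hf.continuousOn⟩

/-- The `k`-fold symmetric product `X^{*k}`: nonempty subsets of `X` with at most `k` points. -/
abbrev SymProd (X : Type*) [TopologicalSpace X] (k : ℕ) :=
  {A : NonemptyCompacts X // (A : Set X).Finite ∧ (A : Set X).ncard ≤ k}

/-- The induced map `f^{*k}` on the `k`-fold symmetric product. -/
noncomputable def inducedSym {X : Type*} [TopologicalSpace X] (f : X → X) (hf : Continuous f)
    (k : ℕ) : SymProd X k → SymProd X k :=
  fun A => ⟨induced2 f hf A.1, A.2.1.image f, le_trans (Set.ncard_image_le A.2.1) A.2.2⟩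

/-- Sets `U 0, …, U (L-1)` are mutually singular for `f`. -/
def MutuallySingularSets {X : Type*} [TopologicalSpace X] (f : X → X) {L : ℕ}
    (U : Fin L → Set X) : Prop :=
  ∀ M : ℕ, ∃ x : X, ∃ n : Fin L → ℕ, (∀ j, 1 ≤ n j ∧ f^[n j] x ∈ U j) ∧
    ∀ i j, i ≠ j → (M : ℤ) < |(n i : ℤ) - (n j : ℤ)|

/-- A finite set `S ⊆ X \ NW(f)` is singular: it consists of mutually singular points, i.e.
every family of respective neighbourhoods of its points is mutually singular. -/
def IsSingularSet {X : Type*} [TopologicalSpace X] (f : X → X) (S : Set X) : Prop :=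
  S.Finite ∧ (∀ x ∈ S, x ∉ nonWandering f) ∧
  ∀ (L : ℕ) (x : Fin L → X), Function.Injective x → Set.range x = S →
    ∀ U : Fin L → Set X, (∀ j, U j ∈ nhds (x j)) → MutuallySingularSets f U

/-- The set of codings of length-`n` orbit segments of points of `Y` relative to the family
`F`, where the letter `none` stands for `Y_∞ = Y \ ⋃ F`. -/
def codings {X : Type*} (f : X → X) {L : ℕ} (F : Fin L → Set X) (Y : Set X) (n : ℕ) :
    Set (Fin n → Option (Fin L)) :=
  {w | ∃ x ∈ Y, ∀ j : Fin n, match w j with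
    | some i => f^[(j : ℕ)] x ∈ F i
    | none => f^[(j : ℕ)] x ∈ Y \ ⋃ i, F i}

/-- The polynomial entropy of `f` on `Y` relative to the family `F`:
`limsup_n log #A_n(F;Y) / log n`. -/
noncomputable def polEntRel {X : Type*} (f : X → X) {L : ℕ} (F : Fin L → Set X) (Y : Set X) :
    ℝ≥0∞ :=
  Filter.atTop.limsup fun n : ℕ =>
    ENNReal.ofReal (Real.log ((codings f F Y n).ncard) / Real.log n)

/-- The circle is connected. -/
theorem circle_isConnected_univ : IsConnected (Set.univ : Set Circle) := by
  have hsurj : Function.Surjective Circle.exp := fun z => ⟨Complex.arg z, Circle.exp_arg z⟩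
  have : ConnectedSpace Circle :=
    { toPreconnectedSpace := ⟨by
        rw [← Set.image_univ_of_surjective hsurj]
        exact isPreconnected_univ.image _ Circle.exp.continuous.continuousOn⟩,
      toNonempty := ⟨1⟩ }
  exact isConnected_univ

section DynDist

variable {X : Type*} [MetricSpace X]

theorem le_dynDist {f : X → X} {n k : ℕ} {x y : X} {ε : ℝ} (hk : k < n)
    (h : ε ≤ dist (f^[k] x) (f^[k] y)) : ε ≤ dynDist f n x y := by
  refine h.trans ?_
  rw [← coe_nndist, dynDist, NNReal.coe_le_coe]
  exact Finset.le_sup (f := fun k => nndist (f^[k] x) (f^[k] y)) (Finset.mem_range.2 hk)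

theorem dynDist_lt {f : X → X} {n : ℕ} {x y : X} {ε : ℝ} (hε : 0 < ε)
    (h : ∀ k < n, dist (f^[k] x) (f^[k] y) < ε) : dynDist f n x y < ε := by
  lift ε to NNReal using hε.le
  rw [dynDist, NNReal.coe_lt_coe, Finset.sup_lt_iff (by simpa using hε)]
  intro k hk
  rw [← NNReal.coe_lt_coe, coe_nndist]
  exact h k (Finset.mem_range.1 hk)

theorem dynDist_self (f : X → X) (n : ℕ) (x : X) : dynDist f n x x = 0 := by
  simp [dynDist]

theorem dynDist_comm (f : X → X) (n : ℕ) (x y : X) : dynDist f n x y = dynDist f n y x := by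
  simp [dynDist, nndist_comm]

end DynDist

theorem coe_iterate_inducedC {X : Type*} [TopologicalSpace X] {f : X → X} (hf : Continuous f)
    (k : ℕ) (A : Subcontinua X) :
    (((inducedC f hf)^[k] A).1 : Set X) = f^[k] '' (A.1 : Set X) := by
  induction k with
  | zero => simp
  | succ k ih =>
    rw [Function.iterate_succ_apply', Function.iterate_succ', image_comp, ← ih]
    rfl

theorem Subcontinua.dist_eq {X : Type*} [MetricSpace X] (A B : Subcontinua X) :
    dist A B = Metric.hausdorffDist (A.1 : Set X) (B.1 : Set X) := rfl

theorem Subcontinua.infDist_le_dist {X : Type*} [MetricSpace X] {A B : Subcontinua X} {m : X}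
    {K : Set X} (hm : m ∈ (A.1 : Set X)) (hK : (B.1 : Set X) ⊆ K) :
    Metric.infDist m K ≤ dist A B := by
  rw [Subcontinua.dist_eq]
  exact (Metric.infDist_le_infDist_of_subset hK B.1.nonempty).trans
    (Metric.infDist_le_hausdorffDist_of_mem hm
      (Metric.hausdorffEDist_ne_top_of_nonempty_of_bounded A.1.nonempty B.1.nonempty
        A.1.isCompact.isBounded B.1.isCompact.isBounded))

theorem isConnected_preimage_iterate {X : Type*} [TopologicalSpace X] (f : X ≃ₜ X) (k : ℕ)
    {D : Set X} (hD : IsConnected D) : IsConnected (f^[k] ⁻¹' D) := by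
  have h : f.symm^[k] '' D = f^[k] ⁻¹' D := congrFun (image_eq_preimage_of_inverse
    (Function.LeftInverse.iterate f.apply_symm_apply k)
    (Function.LeftInverse.iterate f.symm_apply_apply k)) D
  rw [← h]
  exact hD.image _ (f.symm.continuous.iterate k).continuousOn

/-- If `g = f^[M]` maps `D` into itself, `g⁻¹` maps `B` into itself, and some point `m` leaves
`B` and enters `D` at the same step, then the sets `g⁻ⁱ D ∪ g⁻ʲ B` with `i < j` are uniformly
separated by the induced dynamics. -/
theorem exists_separated_sq {X : Type*} [MetricSpace X] [CompactSpace X] (f : X ≃ₜ X) {M : ℕ}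
    (hM : 0 < M) {D B : Set X} (hDc : IsClosed D) (hBc : IsClosed B) (hD : IsConnected D)
    (hB : IsConnected B) {p m : X} (hp : f^[M] p = p) (hpD : p ∈ D) (hpB : p ∈ B)
    (hDD : MapsTo f^[M] D D) (hBB : ∀ w, f^[M] w ∈ B → w ∈ B) (hmB : m ∈ B)
    (hmD : f^[M] m ∈ D) (hmD' : m ∉ D) (hmB' : f^[M] m ∉ B) :
    ∃ ε > 0, ∀ n : ℕ, ∃ E : Finset (Subcontinua X),
      E.card = n * n ∧ IsDynSeparated (inducedC f f.continuous) (M * (2 * n)) ε E := by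
  have hcont : ∀ k, Continuous (f^[k]) := fun k => f.continuous.iterate k
  have hpk : ∀ i, f^[M * i] p = p := fun i => by
    rw [Function.iterate_mul]; exact Function.iterate_fixed hp i
  set K : Set X := D ∪ f^[M] ⁻¹' B with hK
  have hKc : IsClosed K := hDc.union (hBc.preimage (hcont M))
  have hmK : m ∉ K := by simp [hK, hmD', hmB']
  have hDk : ∀ k, MapsTo f^[M * k] D D := fun k => by
    rw [Function.iterate_mul]; exact hDD.iterate k
  have hBk : ∀ k w, f^[M * k] w ∈ B → w ∈ B := by
    intro k
    induction k with
    | zero => simp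
    | succ k ih =>
      intro w hw
      refine ih w (hBB _ ?_)
      rwa [← Function.iterate_add_apply, add_comm, ← Nat.mul_succ]
  have hsplit : ∀ a b w, a ≤ b → f^[M * b] w = f^[M * (b - a)] (f^[M * a] w) := by
    intro a b w hab
    rw [← Function.iterate_add_apply, ← Nat.mul_add, Nat.sub_add_cancel hab]
  have hBs : ∀ a b w, a < b → f^[M * b] w ∈ B → f^[M] (f^[M * a] w) ∈ B := by
    intro a b w hab h
    apply hBk (b - (a + 1))
    rw [← Function.iterate_add_apply (m := M), add_comm M, ← Nat.mul_succ, ← hsplit _ _ _ hab]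
    exact h
  let C : ℕ → ℕ → Subcontinua X := fun i j =>
    ⟨⟨⟨f^[M * i] ⁻¹' D ∪ f^[M * j] ⁻¹' B,
      ((hDc.preimage (hcont _)).union (hBc.preimage (hcont _))).isCompact⟩,
      ⟨p, Or.inl (by simpa [hpk] using hpD)⟩⟩,
      IsConnected.union ⟨p, by simpa [hpk] using hpD, by simpa [hpk] using hpB⟩
        (isConnected_preimage_iterate f _ hD) (isConnected_preimage_iterate f _ hB)⟩
  have hC : ∀ i j, ((C i j).1 : Set X) = f^[M * i] ⁻¹' D ∪ f^[M * j] ⁻¹' B := fun _ _ => rfl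
  have hfst : ∀ N i j i' j', i < N → i < j → i < i' →
      Metric.infDist m K ≤ dynDist (inducedC f f.continuous) (M * N) (C i' j') (C i j) := by
    intro N i j i' j' hN hij hii
    refine le_dynDist (k := M * i) (Nat.mul_lt_mul_of_pos_left hN hM)
      (Subcontinua.infDist_le_dist ?_ ?_)
    · rw [coe_iterate_inducedC, hC]
      obtain ⟨y, rfl⟩ := f.surjective.iterate (M * i) m
      refine ⟨y, Or.inl ?_, rfl⟩
      rw [mem_preimage, hsplit (i + 1) i' y hii]
      apply hDk
      rwa [Nat.mul_succ, add_comm, Function.iterate_add_apply]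
    · rw [coe_iterate_inducedC, hC]
      rintro _ ⟨y, hy | hy, rfl⟩
      · exact Or.inl hy
      · exact Or.inr (hBs _ _ _ hij hy)
  have hsnd : ∀ N i j j', j < N → i < j → j < j' →
      Metric.infDist m K ≤ dynDist (inducedC f f.continuous) (M * N) (C i j) (C i j') := by
    intro N i j j' hN hij hjj
    refine le_dynDist (k := M * j) (Nat.mul_lt_mul_of_pos_left hN hM)
      (Subcontinua.infDist_le_dist ?_ ?_)
    · rw [coe_iterate_inducedC, hC]
      obtain ⟨y, rfl⟩ := f.surjective.iterate (M * j) m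
      exact ⟨y, Or.inr hmB, rfl⟩
    · rw [coe_iterate_inducedC, hC]
      rintro _ ⟨y, hy | hy, rfl⟩
      · refine Or.inl ?_
        rw [hsplit i j y hij.le]
        exact hDk _ hy
      · exact Or.inr (hBs _ _ _ hjj hy)
  have hpos : 0 < Metric.infDist m K := (hKc.notMem_iff_infDist_pos ⟨p, Or.inl hpD⟩).1 hmK
  have hsep : ∀ n, ∀ x ∈ Finset.range n ×ˢ Finset.range n, ∀ y ∈ Finset.range n ×ˢ Finset.range n,
      x ≠ y → Metric.infDist m K ≤ dynDist (inducedC f f.continuous) (M * (2 * n))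
        (C x.1 (n + x.2)) (C y.1 (n + y.2)) := by
    rintro n ⟨i, j⟩ hx ⟨i', j'⟩ hy hne
    simp only [Finset.mem_product, Finset.mem_range] at hx hy
    rcases lt_trichotomy i i' with h | rfl | h
    · rw [dynDist_comm]
      exact hfst _ _ _ _ _ (by omega) (by omega) h
    · rcases lt_trichotomy j j' with h | rfl | h
      · exact hsnd _ _ _ _ (by omega) (by omega) (by omega)
      · exact absurd rfl hne
      · rw [dynDist_comm]
        exact hsnd _ _ _ _ (by omega) (by omega) (by omega)
    · exact hfst _ _ _ _ _ (by omega) (by omega) h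
  refine ⟨_, hpos, fun n => ?_⟩
  classical
  refine ⟨(Finset.range n ×ˢ Finset.range n).image fun x => C x.1 (n + x.2), ?_, ?_⟩
  · rw [Finset.card_image_of_injOn, Finset.card_product, Finset.card_range]
    intro x hx y hy hxy
    by_contra hne
    have h := hsep n x hx y hy hne
    dsimp only at hxy
    rw [hxy, dynDist_self] at h
    exact hpos.not_ge h
  · intro A hA A' hA' hne
    obtain ⟨x, hx, rfl⟩ := Finset.mem_image.1 hA
    obtain ⟨y, hy, rfl⟩ := Finset.mem_image.1 hA'
    exact hsep n x hx y hy fun h => hne (by rw [h])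

open Real in
/-- The branch of the argument on the circle with values in `(θ, θ + 2π]`. -/
noncomputable def argFrom (θ : ℝ) (w : Circle) : ℝ :=
  θ + π + Complex.arg (w * Circle.exp (-(θ + π)) : Circle)

open Real in
theorem exp_argFrom (θ : ℝ) (w : Circle) : Circle.exp (argFrom θ w) = w := by
  rw [argFrom, Circle.exp_add, Circle.exp_arg, mul_comm, mul_assoc, ← Circle.exp_add]
  simp

open Real in
theorem argFrom_mem_Ioc (θ : ℝ) (w : Circle) : argFrom θ w ∈ Ioc θ (θ + 2 * π) := by
  have h1 := Complex.neg_pi_lt_arg (w * Circle.exp (-(θ + π)) : Circle)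
  have h2 := Complex.arg_le_pi (w * Circle.exp (-(θ + π)) : Circle)
  constructor <;> unfold argFrom <;> linarith

open Real in
theorem exp_add_two_pi_eq (θ : ℝ) : Circle.exp (θ + 2 * π) = Circle.exp θ := by
  rw [Circle.exp_add, Circle.exp_two_pi, mul_one]

open Real in
theorem argFrom_mem_Ioo {θ : ℝ} {w : Circle} (hw : w ≠ Circle.exp θ) :
    argFrom θ w ∈ Ioo θ (θ + 2 * π) := by
  refine ⟨(argFrom_mem_Ioc θ w).1, lt_of_le_of_ne (argFrom_mem_Ioc θ w).2 fun h => hw ?_⟩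
  rw [← exp_argFrom θ w, h, exp_add_two_pi_eq]

open Real in
theorem argFrom_exp {θ t : ℝ} (ht : t ∈ Ioc θ (θ + 2 * π)) :
    argFrom θ (Circle.exp t) = t :=
  Circle.exp_injOn_Ioc (by linarith) (argFrom_mem_Ioc _ _) ht (exp_argFrom _ _)

open Real in
theorem exp_ne_of_mem_Ioo {θ t : ℝ} (ht : t ∈ Ioo θ (θ + 2 * π)) :
    Circle.exp t ≠ Circle.exp θ := fun h =>
  ht.1.ne' (Circle.exp_injOn_Ico (a := θ) (b := θ + 2 * π) (by linarith)
    ⟨ht.1.le, ht.2⟩ ⟨le_rfl, by linarith [pi_pos]⟩ h)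

open Real in
theorem continuousAt_argFrom {θ : ℝ} {w : Circle} (hw : w ≠ Circle.exp θ) :
    ContinuousAt (argFrom θ) w := by
  have hc : ContinuousAt (fun w : Circle => ((w * Circle.exp (-(θ + π)) : Circle) : ℂ)) w := by
    fun_prop
  refine continuousAt_const.add (ContinuousAt.comp
    (g := Complex.arg) (f := fun w : Circle => ((w * Circle.exp (-(θ + π)) : Circle) : ℂ))
    (Complex.continuousAt_arg ?_) hc)
  rw [Complex.mem_slitPlane_iff_arg]
  refine ⟨fun h => ?_, Circle.coe_ne_zero _⟩
  have := (argFrom_mem_Ioo hw).2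
  rw [argFrom, h] at this
  linarith

open Real in
/-- Every subcontinuum of the circle is the image of a bounded interval under `Circle.exp`. -/
theorem exists_eq_image_exp_Icc {A : Set Circle} (hA : IsConnected A) (hAc : IsCompact A) :
    ∃ α β : ℝ, 0 ≤ α ∧ α ≤ β ∧ β ≤ 4 * π ∧ A = Circle.exp '' Icc α β := by
  have hpi := pi_pos
  by_cases hu : A = univ
  · refine ⟨0, 2 * π, le_rfl, by positivity, by linarith, ?_⟩
    rw [hu, eq_comm, eq_univ_iff_forall]
    intro w
    have h := argFrom_mem_Ioc 0 w
    exact ⟨argFrom 0 w, ⟨h.1.le, by linarith [h.2]⟩, exp_argFrom 0 w⟩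
  · obtain ⟨z, hz⟩ := (ne_univ_iff_exists_notMem A).1 hu
    set θ := argFrom 0 z with hθ
    have hz' : Circle.exp θ = z := exp_argFrom 0 z
    have hθm := argFrom_mem_Ioc 0 z
    have hne : ∀ w ∈ A, w ≠ Circle.exp θ := fun w hw h => hz (by rwa [← hz', ← h])
    have hcont : ContinuousOn (argFrom θ) A := fun w hw =>
      (continuousAt_argFrom (hne w hw)).continuousWithinAt
    have hconn := hA.image _ hcont
    have hcomp := hAc.image_of_continuousOn hcont
    have hI := eq_Icc_of_connected_compact hconn hcomp
    set α := sInf (argFrom θ '' A)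
    set β := sSup (argFrom θ '' A)
    have hle : α ≤ β := nonempty_Icc.1 (hI ▸ hconn.nonempty)
    have hsub : ∀ t ∈ Icc α β, t ∈ Ioc θ (θ + 2 * π) := by
      rw [← hI]
      rintro _ ⟨w, -, rfl⟩
      exact argFrom_mem_Ioc θ w
    refine ⟨α, β, ?_, hle, ?_, ?_⟩
    · linarith [(hsub α ⟨le_rfl, hle⟩).1, hθm.1]
    · linarith [(hsub β ⟨hle, le_rfl⟩).2, hθm.2]
    · rw [← hI, image_image]
      simp [exp_argFrom]

theorem finite_sphere_circle (c : Circle) {r : ℝ} : (Metric.sphere c r).Finite := by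
  have key : ∀ w ∈ Metric.sphere c r,
      (w : ℂ) ^ 2 + ((r : ℂ) ^ 2 - 2) * c * w + (c : ℂ) ^ 2 = 0 := by
    intro w hw
    have h1 : ‖(w : ℂ) - c‖ = r := by
      rw [← Complex.dist_eq]; exact hw
    have h2 : ((w : ℂ) - c) * ((starRingEnd ℂ) w - (starRingEnd ℂ) c) = r ^ 2 := by
      rw [← map_sub, Complex.mul_conj, Complex.normSq_eq_norm_sq, h1]
      push_cast; rfl
    have hw1 : (w : ℂ) * (starRingEnd ℂ) w = 1 := by
      rw [Complex.mul_conj, Circle.normSq_coe, Complex.ofReal_one]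
    have hc1 : (c : ℂ) * (starRingEnd ℂ) c = 1 := by
      rw [Complex.mul_conj, Circle.normSq_coe, Complex.ofReal_one]
    linear_combination (-(w : ℂ) * c) * h2 + ((w : ℂ) - c) * c * hw1 - ((w : ℂ) - c) * w * hc1
  rcases (Metric.sphere c r).eq_empty_or_nonempty with h | ⟨w₁, hw₁⟩
  · rw [h]; exact finite_empty
  · refine Set.Finite.of_finite_image (f := fun w : Circle => (w : ℂ)) ?_
      Circle.coe_injective.injOn
    refine (toFinite {(w₁ : ℂ), -((w₁ : ℂ) + ((r : ℂ) ^ 2 - 2) * (c : ℂ))}).subset ?_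
    rintro _ ⟨w, hw, rfl⟩
    have h : ((w : ℂ) - w₁) * (w + ((w₁ : ℂ) + ((r : ℂ) ^ 2 - 2) * (c : ℂ))) = 0 := by
      linear_combination key w hw - key w₁ hw₁
    rcases mul_eq_zero.1 h with h | h
    · exact Or.inl (sub_eq_zero.1 h)
    · exact Or.inr (eq_neg_of_add_eq_zero_left h)

/-- Finitely many points cut the circle into pieces of small diameter. -/
theorem exists_finset_cutting {ε : ℝ} (hε : 0 < ε) : ∃ F : Finset Circle,
    ∀ S : Set Circle, IsPreconnected S → Disjoint S (F : Set Circle) →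
      ∀ a ∈ S, ∀ b ∈ S, dist a b < ε := by
  obtain ⟨t, -, htf, hcov⟩ := (isCompact_univ (X := Circle)).finite_cover_balls (half_pos hε)
  have hfin : (⋃ c ∈ t, Metric.sphere c (ε / 2)).Finite :=
    htf.biUnion fun c _ => finite_sphere_circle c
  refine ⟨hfin.toFinset, fun S hS hd a ha b hb => ?_⟩
  rw [Finite.coe_toFinset] at hd
  obtain ⟨c, hct, hac⟩ := mem_iUnion₂.1 (hcov (mem_univ a))
  have hsub : S ⊆ Metric.ball c (ε / 2) := by
    refine hS.subset_left_of_subset_union Metric.isOpen_ball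
      (Metric.isClosed_closedBall (x := c) (ε := ε / 2)).isOpen_compl ?_ ?_ ⟨a, ha, hac⟩
    · exact disjoint_compl_right.mono_left Metric.ball_subset_closedBall
    · intro w hw
      rcases lt_trichotomy (dist w c) (ε / 2) with h | h | h
      · exact Or.inl h
      · exact absurd (mem_iUnion₂.2 ⟨c, hct, h⟩) (disjoint_left.1 hd hw)
      · exact Or.inr (by simpa using h)
  have h1 := hsub ha
  have h2 := hsub hb
  rw [Metric.mem_ball] at h1 h2
  linarith [dist_triangle_right a b c]

/-- Counts the points of `P` up to `t`, those strictly below `t` twice; the count separates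
points of the line that have a point of `P` between them. -/
noncomputable def cutCode (P : Finset ℝ) (t : ℝ) : ℕ :=
  (P.filter (· ≤ t)).card + (P.filter (· < t)).card

theorem cutCode_le (P : Finset ℝ) (t : ℝ) : cutCode P t ≤ 2 * P.card := by
  have h1 := Finset.card_filter_le P (· ≤ t)
  have h2 := Finset.card_filter_le P (· < t)
  unfold cutCode
  omega

theorem notMem_Icc_of_cutCode_eq {P : Finset ℝ} {a b : ℝ} (hab : a < b)
    (h : cutCode P a = cutCode P b) : ∀ p ∈ P, p ∉ Icc a b := by
  intro p hp ⟨hap, hpb⟩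
  have h1 : P.filter (· ≤ a) ⊆ P.filter (· ≤ b) :=
    Finset.monotone_filter_right P fun _ _ hx => le_trans hx hab.le
  have h2 : P.filter (· < a) ⊆ P.filter (· < b) :=
    Finset.monotone_filter_right P fun _ _ hx => lt_trans hx hab
  have h3 := Finset.card_le_card h1
  have h4 := Finset.card_le_card h2
  unfold cutCode at h
  have h5 := Finset.eq_of_subset_of_card_le h1 (by omega)
  have h6 := Finset.eq_of_subset_of_card_le h2 (by omega)
  have h7 : p ∈ P.filter (· ≤ a) := by rw [h5]; exact Finset.mem_filter.2 ⟨hp, hpb⟩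
  have h8 : p ∈ P.filter (· < a) := by
    rw [h6]; exact Finset.mem_filter.2 ⟨hp, (Finset.mem_filter.1 h7).2.trans_lt hab⟩
  exact hap.not_gt (Finset.mem_filter.1 h8).2

open Real in
theorem exists_arg_add_eq {t : ℝ} (h0 : 0 ≤ t) (h4 : t ≤ 4 * π) :
    ∃ m ∈ Finset.range 3, Complex.arg (Circle.exp t) + 2 * π * (m : ℕ) = t := by
  have hpi := pi_pos
  obtain ⟨m, hm⟩ := Circle.exp_eq_exp.1 (Circle.exp_arg (Circle.exp t)).symm
  have h1 := Complex.neg_pi_lt_arg (Circle.exp t : ℂ)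
  have h2 := Complex.arg_le_pi (Circle.exp t : ℂ)
  have hm0 : (-1 : ℝ) < m := by
    by_contra! hc
    nlinarith
  have hm3 : (m : ℝ) < 3 := by
    by_contra! hc
    nlinarith
  have hm0' : (-1 : ℤ) < m := by exact_mod_cast hm0
  have hm3' : m < 3 := by exact_mod_cast hm3
  lift m to ℕ using by omega
  refine ⟨m, Finset.mem_range.2 (by exact_mod_cast hm3'), ?_⟩
  rw [Int.cast_natCast] at hm
  linarith

open Real in
/-- Separated sets of subcontinua of the circle grow at most quadratically. -/
theorem exists_card_le_sq (f : Circle ≃ₜ Circle) {ε : ℝ} (hε : 0 < ε) :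
    ∃ C : ℕ, ∀ (n : ℕ) (E : Finset (Subcontinua Circle)),
      IsDynSeparated (inducedC f f.continuous) n ε E → E.card ≤ (C * n + 1) ^ 2 := by
  classical
  obtain ⟨F, hF⟩ := exists_finset_cutting (half_pos hε)
  refine ⟨6 * F.card, fun n E hE => ?_⟩
  set P : Finset ℝ := (Finset.range n ×ˢ F ×ˢ Finset.range 3).image fun x =>
    Complex.arg (f.symm^[x.1] x.2.1) + 2 * π * (x.2.2 : ℕ) with hP
  have hPcard : P.card ≤ 3 * F.card * n := by
    refine Finset.card_image_le.trans (le_of_eq ?_)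
    rw [Finset.card_product, Finset.card_product, Finset.card_range, Finset.card_range]
    ring
  have hPmem : ∀ k < n, ∀ t, 0 ≤ t → t ≤ 4 * π → f^[k] (Circle.exp t) ∈ F → t ∈ P := by
    intro k hk t h0 h4 hmem
    obtain ⟨m, hm, hmt⟩ := exists_arg_add_eq h0 h4
    refine Finset.mem_image.2 ⟨(k, f^[k] (Circle.exp t), m), ?_, ?_⟩
    · simp only [Finset.mem_product]
      exact ⟨Finset.mem_range.2 hk, hmem, hm⟩
    · have hinv : f.symm^[k] (f^[k] (Circle.exp t)) = Circle.exp t :=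
        Function.LeftInverse.iterate f.left_inv k _
      simp only [hinv, hmt]
  have hclose : ∀ k < n, ∀ a b, 0 ≤ a → b ≤ 4 * π → cutCode P a = cutCode P b →
      ∀ s ∈ Icc a b, ∀ t ∈ Icc a b, dist (f^[k] (Circle.exp s)) (f^[k] (Circle.exp t)) < ε / 2 := by
    intro k hk a b h0 h4 hcode s hs t ht
    rcases (hs.1.trans hs.2).eq_or_lt with rfl | hab
    · rw [Icc_self, mem_singleton_iff] at hs ht
      rw [hs, ht, dist_self]
      exact half_pos hε
    · refine hF ((fun s => f^[k] (Circle.exp s)) '' Icc a b) ?_ ?_ _ ⟨s, hs, rfl⟩ _ ⟨t, ht, rfl⟩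
      · exact isPreconnected_Icc.image _
          ((f.continuous.iterate k).comp Circle.exp.continuous).continuousOn
      · rw [disjoint_left]
        rintro _ ⟨u, hu, rfl⟩ hmem
        exact notMem_Icc_of_cutCode_eq hab hcode u
          (hPmem k hk u (h0.trans hu.1) (hu.2.trans h4) hmem) hu
  choose α β hα hαβ hβ hA using fun A : Subcontinua Circle =>
    exists_eq_image_exp_Icc A.2 A.1.isCompact
  have hhalf : ∀ k < n, ∀ A A' : Subcontinua Circle, cutCode P (α A) = cutCode P (α A') →
      cutCode P (β A) = cutCode P (β A') → ∀ x ∈ f^[k] '' (A.1 : Set Circle),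
      ∃ y ∈ f^[k] '' (A'.1 : Set Circle), dist x y ≤ ε / 2 := by
    intro k hk A A' h1 h2 x hx
    rw [hA A] at hx
    rw [hA A']
    obtain ⟨_, ⟨s, hs, rfl⟩, rfl⟩ := hx
    rcases lt_or_ge s (α A') with h | h
    · refine ⟨_, ⟨_, ⟨α A', ⟨le_rfl, hαβ A'⟩, rfl⟩, rfl⟩, ?_⟩
      exact (hclose k hk (α A) (α A') (hα A) ((hαβ A').trans (hβ A')) h1 s ⟨hs.1, h.le⟩ _
        ⟨hs.1.trans h.le, le_rfl⟩).le
    rcases lt_or_ge (β A') s with h' | h'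
    · refine ⟨_, ⟨_, ⟨β A', ⟨hαβ A', le_rfl⟩, rfl⟩, rfl⟩, ?_⟩
      exact (hclose k hk (β A') (β A) ((hα A').trans (hαβ A')) (hβ A) h2.symm s ⟨h'.le, hs.2⟩ _
        ⟨le_rfl, h'.le.trans hs.2⟩).le
    · exact ⟨_, ⟨_, ⟨s, ⟨h, h'⟩, rfl⟩, rfl⟩, by rw [dist_self]; exact (half_pos hε).le⟩
  have hcard := Finset.card_le_card_of_injOn (s := E)
    (t := Finset.range (6 * F.card * n + 1) ×ˢ Finset.range (6 * F.card * n + 1))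
    (fun A => (cutCode P (α A), cutCode P (β A))) ?_ ?_
  · rwa [Finset.card_product, Finset.card_range, ← sq] at hcard
  · intro A _
    have h1 := cutCode_le P (α A)
    have h2 := cutCode_le P (β A)
    have h3 : 6 * F.card * n = 2 * (3 * F.card * n) := by ring
    simp only [Finset.coe_product, mem_prod, Finset.coe_range, mem_Iio]
    omega
  · intro A hAE A' hAE' hcode
    simp only [Prod.mk.injEq] at hcode
    by_contra hne
    refine (hE A hAE A' hAE' hne).not_gt (dynDist_lt hε fun k hk => ?_)
    rw [Subcontinua.dist_eq, coe_iterate_inducedC, coe_iterate_inducedC]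
    refine (Metric.hausdorffDist_le_of_mem_dist (half_pos hε).le
      (hhalf k hk A A' hcode.1 hcode.2) fun x hx => ?_).trans_lt (half_lt_self hε)
    obtain ⟨y, hy, hxy⟩ := hhalf k hk A' A hcode.1.symm hcode.2.symm x hx
    exact ⟨y, hy, hxy⟩

theorem mem_nonWandering_of_iterate_eq {X : Type*} [TopologicalSpace X] {f : X → X} {x : X}
    {n : ℕ} (hn : 1 ≤ n) (h : f^[n] x = x) : x ∈ nonWandering f := fun _ hU =>
  ⟨n, hn, x, ⟨x, mem_of_mem_nhds hU, h⟩, mem_of_mem_nhds hU⟩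

theorem mapsTo_nonWandering {X : Type*} [TopologicalSpace X] {f : X → X} (hf : Continuous f) :
    MapsTo f (nonWandering f) (nonWandering f) := by
  intro p hp U hU
  obtain ⟨n, hn, _, ⟨y, hy, rfl⟩, hy'⟩ := hp _ (hf.continuousAt.preimage_mem_nhds hU)
  refine ⟨n, hn, f (f^[n] y), ⟨f y, hy, ?_⟩, hy'⟩
  rw [← Function.iterate_succ_apply, Function.iterate_succ_apply']

theorem exists_periodic_of_finite_nonWandering {X : Type*} [TopologicalSpace X] {f : X → X}
    (hf : Continuous f) (hinj : Function.Injective f) (hfin : (nonWandering f).Finite)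
    (hne : (nonWandering f).Nonempty) :
    ∃ p ∈ nonWandering f, ∃ N, 0 < N ∧ f^[N] p = p := by
  obtain ⟨p, hp⟩ := hne
  have := hfin.to_subtype
  have hm := mapsTo_nonWandering hf
  obtain ⟨N, hN, h⟩ := Function.Injective.mem_periodicPts
    (hm.restrict_inj.2 hinj.injOn) (⟨p, hp⟩ : nonWandering f)
  refine ⟨p, hp, N, hN, ?_⟩
  have h' := congrArg Subtype.val h
  rwa [hm.iterate_restrict, MapsTo.val_restrict_apply] at h'

theorem infinite_circle : Infinite Circle := by
  have h := Circle.exp_injOn_Icc (a := 0) (b := 1) (by linarith [Real.pi_gt_three])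
  exact Set.infinite_univ_iff.1 (((Icc_infinite (zero_lt_one' ℝ)).image h).mono (subset_univ _))

open Real in
theorem exp_mem_image_Icc_right {θ a t : ℝ} (ha : θ < a) (ht : t ∈ Ioo θ (θ + 2 * π)) :
    Circle.exp t ∈ Circle.exp '' Icc a (θ + 2 * π) ↔ a ≤ t := by
  refine ⟨?_, fun h => ⟨t, ⟨h, ht.2.le⟩, rfl⟩⟩
  rintro ⟨u, hu, h⟩
  rw [← Circle.exp_injOn_Ioc (a := θ) (b := θ + 2 * π) (by linarith)
    ⟨ha.trans_le hu.1, hu.2⟩ ⟨ht.1, ht.2.le⟩ h]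
  exact hu.1

open Real in
theorem exp_mem_image_Icc_left {θ a t : ℝ} (ha : a < θ + 2 * π) (ht : t ∈ Ioo θ (θ + 2 * π)) :
    Circle.exp t ∈ Circle.exp '' Icc θ a ↔ t ≤ a := by
  refine ⟨?_, fun h => ⟨t, ⟨ht.1.le, h⟩, rfl⟩⟩
  rintro ⟨u, hu, h⟩
  rw [← Circle.exp_injOn_Ico (a := θ) (b := θ + 2 * π) (by linarith)
    ⟨hu.1, hu.2.trans_lt ha⟩ ⟨ht.1.le, ht.2⟩ h]
  exact hu.2

theorem isConnected_exp_image_Icc {a b : ℝ} (h : a ≤ b) : IsConnected (Circle.exp '' Icc a b) :=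
  (isConnected_Icc h).image _ Circle.exp.continuous.continuousOn

theorem isClosed_exp_image_Icc (a b : ℝ) : IsClosed (Circle.exp '' Icc a b) :=
  (isCompact_Icc.image Circle.exp.continuous).isClosed

open Real in
/-- In the angular coordinate on the complement of a periodic point, some iterate is given by a
continuous strictly increasing map. -/
theorem exists_strictMonoOn_lift (f : Circle ≃ₜ Circle) {θ : ℝ} {N : ℕ}
    (hN : f^[N] (Circle.exp θ) = Circle.exp θ) :
    ∃ G : ℝ → ℝ, MapsTo G (Ioo θ (θ + 2 * π)) (Ioo θ (θ + 2 * π)) ∧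
      ContinuousOn G (Ioo θ (θ + 2 * π)) ∧ StrictMonoOn G (Ioo θ (θ + 2 * π)) ∧
      ∀ t, Circle.exp (G t) = f^[2 * N] (Circle.exp t) := by
  have hpi := pi_pos
  have hinj : Function.Injective f^[N] := f.injective.iterate N
  set H : ℝ → ℝ := fun t => argFrom θ (f^[N] (Circle.exp t)) with hH
  have hexp : ∀ t, Circle.exp (H t) = f^[N] (Circle.exp t) := fun t => exp_argFrom _ _
  have hne : ∀ t ∈ Ioo θ (θ + 2 * π), f^[N] (Circle.exp t) ≠ Circle.exp θ := fun t ht h =>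
    exp_ne_of_mem_Ioo ht (hinj (h.trans hN.symm))
  have hmaps : MapsTo H (Ioo θ (θ + 2 * π)) (Ioo θ (θ + 2 * π)) := fun t ht =>
    argFrom_mem_Ioo (hne t ht)
  have hcont : ContinuousOn H (Ioo θ (θ + 2 * π)) := fun t ht =>
    (ContinuousAt.comp (g := argFrom θ) (f := fun t => f^[N] (Circle.exp t))
      (continuousAt_argFrom (hne t ht))
      ((f.continuous.iterate N).comp Circle.exp.continuous).continuousAt).continuousWithinAt
  have hHinj : InjOn H (Ioo θ (θ + 2 * π)) := by
    intro s hs t ht hst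
    have h : f^[N] (Circle.exp s) = f^[N] (Circle.exp t) := by rw [← hexp, ← hexp, hst]
    exact Circle.exp_injOn_Ioc (a := θ) (b := θ + 2 * π) (by linarith)
      ⟨hs.1, hs.2.le⟩ ⟨ht.1, ht.2.le⟩ (hinj h)
  refine ⟨H ∘ H, hmaps.comp hmaps, hcont.comp hcont hmaps, ?_, fun t => ?_⟩
  · rcases hcont.strictMonoOn_of_injOn_Ioo (by linarith) hHinj with h | h
    · exact h.comp h hmaps
    · exact h.comp h hmaps
  · rw [Function.comp_apply, hexp, hexp, ← Function.iterate_add_apply, two_mul]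

open Real in
theorem exists_separated_sq_circle (f : Circle ≃ₜ Circle) (hNW : (nonWandering f).Finite)
    (hne : (nonWandering f).Nonempty) :
    ∃ M > 0, ∃ ε > 0, ∀ n : ℕ, ∃ E : Finset (Subcontinua Circle),
      E.card = n * n ∧ IsDynSeparated (inducedC f f.continuous) (M * (2 * n)) ε E := by
  have hpi := pi_pos
  have := infinite_circle
  obtain ⟨p, hpNW, N, hN0, hNp⟩ :=
    exists_periodic_of_finite_nonWandering f.continuous f.injective hNW hne
  obtain ⟨x, hx⟩ := hNW.exists_notMem
  obtain ⟨θ, rfl⟩ : ∃ θ, Circle.exp θ = p := ⟨_, Circle.exp_arg p⟩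
  obtain ⟨G, hGm, hGc, hG, hGe⟩ := exists_strictMonoOn_lift f hNp
  have hM : 0 < 2 * N := by omega
  have hxp : x ≠ Circle.exp θ := fun h => hx (h ▸ hpNW)
  obtain ⟨t₀, ht₀, rfl⟩ : ∃ t₀ ∈ Ioo θ (θ + 2 * π), Circle.exp t₀ = x :=
    ⟨_, argFrom_mem_Ioo hxp, exp_argFrom _ _⟩
  have hfix : f^[2 * N] (Circle.exp θ) = Circle.exp θ := by
    rw [two_mul, Function.iterate_add_apply, hNp, hNp]
  have hGt : G t₀ ≠ t₀ := fun h =>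
    hx (mem_nonWandering_of_iterate_eq hM (by rw [← hGe, h]))
  have hGat : ContinuousAt G t₀ := hGc.continuousAt (Ioo_mem_nhds ht₀.1 ht₀.2)
  have hI := Ioo_mem_nhds ht₀.1 ht₀.2
  have hRp : Circle.exp θ ∈ Circle.exp '' Icc t₀ (θ + 2 * π) :=
    ⟨θ + 2 * π, ⟨ht₀.2.le, le_rfl⟩, exp_add_two_pi_eq θ⟩
  have hLp : Circle.exp θ ∈ Circle.exp '' Icc θ t₀ := ⟨θ, ⟨le_rfl, ht₀.1.le⟩, rfl⟩
  have hcases : ∀ w, w = Circle.exp θ ∨ ∃ t ∈ Ioo θ (θ + 2 * π), Circle.exp t = w := fun w =>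
    or_iff_not_imp_left.2 fun h => ⟨_, argFrom_mem_Ioo h, exp_argFrom _ _⟩
  have hR : ∀ t ∈ Ioo θ (θ + 2 * π),
      (Circle.exp t ∈ Circle.exp '' Icc t₀ (θ + 2 * π) ↔ t₀ ≤ t) := fun t ht =>
    exp_mem_image_Icc_right ht₀.1 ht
  have hL : ∀ t ∈ Ioo θ (θ + 2 * π), (Circle.exp t ∈ Circle.exp '' Icc θ t₀ ↔ t ≤ t₀) :=
    fun t ht => exp_mem_image_Icc_left ht₀.2 ht
  have hRconn := isConnected_exp_image_Icc ht₀.2.le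
  have hLconn := isConnected_exp_image_Icc ht₀.1.le
  refine ⟨2 * N, hM, ?_⟩
  rcases hGt.lt_or_gt with hlt | hlt
  · obtain ⟨s, ⟨hs, hGs⟩, hst : t₀ < s⟩ :=
      (((eventually_of_mem hI fun _ h => h).and (hGat.eventually_lt_const hlt)).filter_mono
        nhdsWithin_le_nhds |>.and (self_mem_nhdsWithin (s := Ioi t₀))).exists
    refine exists_separated_sq f hM (isClosed_exp_image_Icc _ _) (isClosed_exp_image_Icc _ _)
      hLconn hRconn hfix hLp hRp (m := Circle.exp s) ?_ ?_ ?_ ?_ ?_ ?_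
    · intro w hw
      rcases hcases w with rfl | ⟨t, ht, rfl⟩
      · rwa [hfix]
      · rw [← hGe, hL _ (hGm ht)]
        exact (hG.monotoneOn ht ht₀ ((hL t ht).1 hw)).trans hlt.le
    · intro w hw
      rcases hcases w with rfl | ⟨t, ht, rfl⟩
      · exact hRp
      · rw [← hGe, hR _ (hGm ht)] at hw
        rw [hR t ht]
        by_contra! hc
        linarith [hG ht ht₀ hc]
    · exact (hR s hs).2 hst.le
    · rw [← hGe, hL _ (hGm hs)]
      exact hGs.le
    · rw [hL s hs]
      exact hst.not_ge
    · rw [← hGe, hR _ (hGm hs)]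
      exact hGs.not_ge
  · obtain ⟨s, ⟨hs, hGs⟩, hst : s < t₀⟩ :=
      (((eventually_of_mem hI fun _ h => h).and (hGat.eventually_const_lt hlt)).filter_mono
        nhdsWithin_le_nhds |>.and (self_mem_nhdsWithin (s := Iio t₀))).exists
    refine exists_separated_sq f hM (isClosed_exp_image_Icc _ _) (isClosed_exp_image_Icc _ _)
      hRconn hLconn hfix hRp hLp (m := Circle.exp s) ?_ ?_ ?_ ?_ ?_ ?_
    · intro w hw
      rcases hcases w with rfl | ⟨t, ht, rfl⟩
      · rwa [hfix]
      · rw [← hGe, hR _ (hGm ht)]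
        exact hlt.le.trans (hG.monotoneOn ht₀ ht ((hR t ht).1 hw))
    · intro w hw
      rcases hcases w with rfl | ⟨t, ht, rfl⟩
      · exact hLp
      · rw [← hGe, hL _ (hGm ht)] at hw
        rw [hL t ht]
        by_contra! hc
        linarith [hG ht₀ ht hc]
    · exact (hL s hs).2 hst.le
    · rw [← hGe, hR _ (hGm hs)]
      exact hGs.le
    · rw [hR s hs]
      exact hst.not_ge
    · rw [← hGe, hL _ (hGm hs)]
      exact hGs.not_ge

theorem polEnt_le_two {X : Type*} [MetricSpace X] {f : X → X} {Y : Set X}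
    (h : ∀ ε > 0, ∃ C : ℕ, ∀ (n : ℕ) (E : Finset X),
      IsDynSeparated f n ε E → E.card ≤ (C * n + 1) ^ 2) : polEnt f Y ≤ 2 := by
  refine iSup₂_le fun ε hε => ?_
  obtain ⟨C, hC⟩ := h ε hε
  have hlog : Tendsto (fun n : ℕ => Real.log n) atTop atTop :=
    Real.tendsto_log_atTop.comp tendsto_natCast_atTop_atTop
  have hlim : Tendsto (fun n : ℕ => ENNReal.ofReal (2 + 2 * Real.log (C + 1) / Real.log n))
      atTop (𝓝 2) := by
    have h2 : Tendsto (fun n : ℕ => 2 + 2 * Real.log (C + 1) / Real.log n) atTop (𝓝 (2 + 0)) :=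
      tendsto_const_nhds.add (tendsto_const_nhds.div_atTop hlog)
    simpa using ENNReal.tendsto_ofReal h2
  rw [← hlim.limsup_eq]
  refine limsup_le_limsup ?_
  filter_upwards [eventually_ge_atTop 2] with n hn
  refine ENNReal.ofReal_le_ofReal ?_
  have hn' : (2 : ℝ) ≤ n := by exact_mod_cast hn
  have hlogn : 0 < Real.log n := Real.log_pos (by linarith)
  have hle : maxSep f Y n ε ≤ ((C + 1) * n) ^ 2 := by
    refine csSup_le' ?_
    rintro _ ⟨E, -, rfl, hE⟩
    refine (hC n E hE).trans (Nat.pow_le_pow_left ?_ 2)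
    nlinarith
  have hmain : Real.log (maxSep f Y n ε) ≤ 2 * Real.log (C + 1) + 2 * Real.log n := by
    have hC1 : (1 : ℝ) ≤ C + 1 := by linarith [(Nat.cast_nonneg C : (0 : ℝ) ≤ C)]
    rcases Nat.eq_zero_or_pos (maxSep f Y n ε) with h0 | h0
    · rw [h0, Nat.cast_zero, Real.log_zero]
      have := Real.log_nonneg hC1
      positivity
    · calc Real.log (maxSep f Y n ε) ≤ Real.log ((((C + 1) * n) ^ 2 : ℕ) : ℝ) :=
            Real.log_le_log (by exact_mod_cast h0) (by exact_mod_cast hle)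
        _ = 2 * Real.log (C + 1) + 2 * Real.log n := by
            push_cast
            rw [Real.log_pow, Real.log_mul (by linarith) (by linarith)]
            push_cast
            ring
  rw [div_le_iff₀ hlogn, add_mul, div_mul_cancel₀ _ hlogn.ne']
  linarith

theorem two_le_polEnt {X : Type*} [MetricSpace X] {f : X → X} {ε : ℝ} (hε : 0 < ε) {L : ℕ}
    (hL : 0 < L) (h : ∀ n, n * n ≤ maxSep f univ (L * n) ε) : 2 ≤ polEnt f univ := by
  refine le_iSup₂_of_le ε hε ?_
  have hlog : Tendsto (fun n : ℕ => Real.log n) atTop atTop :=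
    Real.tendsto_log_atTop.comp tendsto_natCast_atTop_atTop
  have hlim : Tendsto (fun n : ℕ => ENNReal.ofReal (2 / (Real.log L / Real.log n + 1)))
      atTop (𝓝 2) := by
    have h2 : Tendsto (fun n : ℕ => 2 / (Real.log L / Real.log n + 1)) atTop (𝓝 (2 / (0 + 1))) :=
      tendsto_const_nhds.div ((tendsto_const_nhds.div_atTop hlog).add tendsto_const_nhds)
        (by norm_num)
    simpa using ENNReal.tendsto_ofReal h2
  have hsub : Tendsto (fun n : ℕ => L * n) atTop atTop := tendsto_id.const_mul_atTop' hL
  rw [← hlim.limsup_eq]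
  set u : ℕ → ℝ≥0∞ := fun n => ENNReal.ofReal (Real.log (maxSep f univ n ε) / Real.log n)
  have hcomp : limsup (u ∘ fun n : ℕ => L * n) atTop ≤ limsup u atTop := by
    rw [limsup_comp]
    exact limsup_le_limsup_of_le hsub
  refine le_trans ?_ hcomp
  refine limsup_le_limsup ?_
  filter_upwards [eventually_ge_atTop 2] with n hn
  refine ENNReal.ofReal_le_ofReal ?_
  have hn' : (2 : ℝ) ≤ n := by exact_mod_cast hn
  have hL' : (1 : ℝ) ≤ L := by exact_mod_cast hL
  have hlogn : 0 < Real.log n := Real.log_pos (by linarith)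
  have hlogL : 0 ≤ Real.log L := Real.log_nonneg hL'
  have h2 : 2 * Real.log n ≤ Real.log (maxSep f univ (L * n) ε) := by
    calc 2 * Real.log n = Real.log ((n * n : ℕ) : ℝ) := by
          push_cast
          rw [Real.log_mul (by linarith) (by linarith)]
          ring
      _ ≤ _ := Real.log_le_log (by push_cast; positivity) (by exact_mod_cast h n)
  rw [Nat.cast_mul, Real.log_mul (by linarith) (by linarith)]
  calc 2 / (Real.log L / Real.log n + 1) = 2 * Real.log n / (Real.log L + Real.log n) := by
        field_simp
    _ ≤ _ := by gcongr

-- STATEMENT 3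
theorem stmt3 (f : Circle ≃ₜ Circle) (hNW : (nonWandering ⇑f).Finite)
    (hne : (nonWandering ⇑f).Nonempty) :
    polEnt (inducedC ⇑f f.continuous) Set.univ = 2 := by
  refine le_antisymm (polEnt_le_two fun ε hε => exists_card_le_sq f hε) ?_
  obtain ⟨M, hM, ε, hε, h⟩ := exists_separated_sq_circle f hNW hne
  obtain ⟨C, hC⟩ := exists_card_le_sq f hε
  refine two_le_polEnt hε (L := M * 2) (by omega) fun n => ?_
  obtain ⟨E, hcard, hE⟩ := h n
  rw [mul_assoc]
  refine le_csSup ⟨(C * (M * (2 * n)) + 1) ^ 2, ?_⟩ ⟨E, subset_univ _, hcard, hE⟩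
  rintro _ ⟨E', -, rfl, hE'⟩
  exact hC _ _ hE'
end

section
/- Let f : [0,1] → [0,1] be a homeomorphism such that NW(f) = Fix(f) and this set is finite. Then NW(C(f)) = Fix(C(f)), and this set is finite; more precisely, Fix(C(f)) consists exactly of the intervals [a,b] ⊆ [0,1] with a, b ∈ Fix(f). -/
open Filter Topology TopologicalSpace Set
open scoped ENNReal

/-- The minimum of a nonempty compact set depends continuously on the set. -/
theorem continuous_sInf_nonemptyCompacts {α : Type*} [ConditionallyCompleteLinearOrder α]
    [TopologicalSpace α] [OrderTopology α] :
    Continuous fun K : NonemptyCompacts α => sInf (K : Set α) := by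
  refine OrderTopology.continuous_iff.2 fun c => ⟨?_, ?_⟩
  · convert NonemptyCompacts.isOpen_subsets_of_isOpen (isOpen_Ioi (a := c)) using 1
    ext K
    exact ⟨fun h x hx => lt_of_lt_of_le h (csInf_le K.isCompact.bddBelow hx),
      fun h => h (K.isCompact.sInf_mem K.nonempty)⟩
  · convert NonemptyCompacts.isOpen_inter_nonempty_of_isOpen (isOpen_Iio (a := c)) using 1
    ext K
    exact ⟨fun h => ⟨_, K.isCompact.sInf_mem K.nonempty, h⟩,
      fun ⟨x, hx, hxc⟩ => lt_of_le_of_lt (csInf_le K.isCompact.bddBelow hx) hxc⟩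

/-- The maximum of a nonempty compact set depends continuously on the set. -/
theorem continuous_sSup_nonemptyCompacts {α : Type*} [ConditionallyCompleteLinearOrder α]
    [TopologicalSpace α] [OrderTopology α] :
    Continuous fun K : NonemptyCompacts α => sSup (K : Set α) := by
  refine OrderTopology.continuous_iff.2 fun c => ⟨?_, ?_⟩
  · convert NonemptyCompacts.isOpen_inter_nonempty_of_isOpen (isOpen_Ioi (a := c)) using 1
    ext K
    exact ⟨fun h => ⟨_, K.isCompact.sSup_mem K.nonempty, h⟩,
      fun ⟨x, hx, hxc⟩ => lt_of_lt_of_le hxc (le_csSup K.isCompact.bddAbove hx)⟩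
  · convert NonemptyCompacts.isOpen_subsets_of_isOpen (isOpen_Iio (a := c)) using 1
    ext K
    exact ⟨fun h x hx => lt_of_le_of_lt (le_csSup K.isCompact.bddAbove hx) h,
      fun h => h (K.isCompact.sSup_mem K.nonempty)⟩

/-- A continuous semiconjugacy maps non-wandering points to non-wandering points. -/
theorem Function.Semiconj.map_mem_nonWandering {X Y : Type*} [TopologicalSpace X]
    [TopologicalSpace Y] {h : X → Y} {F : X → X} {g : Y → Y} (hs : Function.Semiconj h F g)
    (hc : Continuous h) {p : X} (hp : p ∈ nonWandering F) : h p ∈ nonWandering g := by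
  intro U hU
  obtain ⟨n, hn, _, ⟨x, hx, rfl⟩, hxU⟩ := hp _ (hc.continuousAt hU)
  refine ⟨n, hn, g^[n] (h x), ⟨h x, hx, rfl⟩, ?_⟩
  rw [← (hs.iterate_right n) x]
  exact hxU

/-- A periodic point is non-wandering. -/
theorem Function.IsPeriodicPt.mem_nonWandering {X : Type*} [TopologicalSpace X] {f : X → X}
    {n : ℕ} {p : X} (hp : Function.IsPeriodicPt f n p) (hn : 1 ≤ n) : p ∈ nonWandering f :=
  fun _ hU => ⟨n, hn, p, ⟨p, mem_of_mem_nhds hU, hp⟩, mem_of_mem_nhds hU⟩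

/-- A homeomorphism of the interval all of whose non-wandering points are fixed is increasing. -/
theorem strictMono_of_nonWandering_subset_fixedPoints (f : ↥unitInterval ≃ₜ ↥unitInterval)
    (hfix : nonWandering ⇑f ⊆ Function.fixedPoints ⇑f) : StrictMono f := by
  refine (f.continuous.strictMono_of_inj f.injective).resolve_right fun hanti => ?_
  have h0 : f 0 = 1 := by
    obtain ⟨x, hx⟩ := f.surjective 1
    exact le_antisymm unitInterval.le_one' (hx ▸ hanti.antitone unitInterval.nonneg')
  have h1 : f 1 = 0 := by
    obtain ⟨x, hx⟩ := f.surjective 0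
    exact le_antisymm (hx ▸ hanti.antitone unitInterval.le_one') unitInterval.nonneg'
  have hper : Function.IsPeriodicPt f 2 0 := by
    change f (f 0) = 0
    rw [h0, h1]
  have h00 : f 0 = 0 := hfix (hper.mem_nonWandering one_le_two)
  exact zero_ne_one (h00.symm.trans h0)

theorem Subcontinua.eq_Icc_sInf_sSup {α : Type*} [ConditionallyCompleteLinearOrder α]
    [TopologicalSpace α] [OrderTopology α] (A : Subcontinua α) :
    (A.1 : Set α) = Set.Icc (sInf (A.1 : Set α)) (sSup (A.1 : Set α)) :=
  eq_Icc_csInf_csSup_of_connected_bdd_closed A.2 A.1.isCompact.bddBelow A.1.isCompact.bddAbove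
    A.1.isCompact.isClosed

theorem Subcontinua.ext_of_sInf_sSup {α : Type*} [ConditionallyCompleteLinearOrder α]
    [TopologicalSpace α] [OrderTopology α] {A B : Subcontinua α}
    (hinf : sInf (A.1 : Set α) = sInf (B.1 : Set α))
    (hsup : sSup (A.1 : Set α) = sSup (B.1 : Set α)) : A = B := by
  refine Subtype.ext (SetLike.coe_injective ?_)
  rw [A.eq_Icc_sInf_sSup, B.eq_Icc_sInf_sSup, hinf, hsup]

/-- Taking the left end point semiconjugates `C(f)` to `f`, for `f` monotone. -/
theorem semiconj_sInf_inducedC {α : Type*} [ConditionallyCompleteLinearOrder α]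
    [TopologicalSpace α] [OrderTopology α] {f : α → α} (hf : Continuous f) (hm : Monotone f) :
    Function.Semiconj (fun A : Subcontinua α => sInf (A.1 : Set α)) (inducedC f hf) f := by
  intro A
  have hleast := A.1.isCompact.isLeast_sInf A.1.nonempty
  exact (hm.map_isLeast hleast).csInf_eq

/-- Taking the right end point semiconjugates `C(f)` to `f`, for `f` monotone. -/
theorem semiconj_sSup_inducedC {α : Type*} [ConditionallyCompleteLinearOrder α]
    [TopologicalSpace α] [OrderTopology α] {f : α → α} (hf : Continuous f) (hm : Monotone f) :
    Function.Semiconj (fun A : Subcontinua α => sSup (A.1 : Set α)) (inducedC f hf) f := by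
  intro A
  have hgreatest := A.1.isCompact.isGreatest_sSup A.1.nonempty
  exact (hm.map_isGreatest hgreatest).csSup_eq

/-- For `f` monotone, a subcontinuum is fixed by `C(f)` iff `f` fixes its end points. -/
theorem mem_fixedPoints_inducedC_iff {α : Type*} [ConditionallyCompleteLinearOrder α]
    [TopologicalSpace α] [OrderTopology α] {f : α → α} (hf : Continuous f) (hm : Monotone f)
    (A : Subcontinua α) :
    A ∈ Function.fixedPoints (inducedC f hf) ↔
      sInf (A.1 : Set α) ∈ Function.fixedPoints f ∧
        sSup (A.1 : Set α) ∈ Function.fixedPoints f := by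
  refine ⟨fun h => ⟨Function.IsFixedPt.map h (semiconj_sInf_inducedC hf hm),
    Function.IsFixedPt.map h (semiconj_sSup_inducedC hf hm)⟩, fun ⟨hinf, hsup⟩ => ?_⟩
  exact Subcontinua.ext_of_sInf_sSup ((semiconj_sInf_inducedC hf hm A).trans hinf)
    ((semiconj_sSup_inducedC hf hm A).trans hsup)

-- STATEMENT 6
theorem stmt6 (f : ↥unitInterval ≃ₜ ↥unitInterval)
    (hfix : nonWandering ⇑f = Function.fixedPoints ⇑f)
    (hfin : (Function.fixedPoints ⇑f).Finite) :
    nonWandering (inducedC ⇑f f.continuous) = Function.fixedPoints (inducedC ⇑f f.continuous) ∧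
    (Function.fixedPoints (inducedC ⇑f f.continuous)).Finite ∧
    Function.fixedPoints (inducedC ⇑f f.continuous) =
      {A : Subcontinua ↥unitInterval | ∃ a b : ↥unitInterval,
        a ∈ Function.fixedPoints ⇑f ∧ b ∈ Function.fixedPoints ⇑f ∧ a ≤ b ∧
        (A.1 : Set ↥unitInterval) = Set.Icc a b} := by
  have hm := (strictMono_of_nonWandering_subset_fixedPoints f hfix.subset).monotone
  have hiff := mem_fixedPoints_inducedC_iff f.continuous hm
  refine ⟨Subset.antisymm (fun A hA => (hiff A).2 ⟨?_, ?_⟩) fun A hA =>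
    Function.IsPeriodicPt.mem_nonWandering (n := 1) hA le_rfl, ?_, ?_⟩
  · exact hfix.subset ((semiconj_sInf_inducedC f.continuous hm).map_mem_nonWandering
      (continuous_sInf_nonemptyCompacts.comp continuous_subtype_val) hA)
  · exact hfix.subset ((semiconj_sSup_inducedC f.continuous hm).map_mem_nonWandering
      (continuous_sSup_nonemptyCompacts.comp continuous_subtype_val) hA)
  · refine Set.Finite.of_injOn
      (f := fun A : Subcontinua ↥unitInterval => (sInf (A.1 : Set _), sSup (A.1 : Set _)))
      (fun A hA => Set.mk_mem_prod ((hiff A).1 hA).1 ((hiff A).1 hA).2) ?_ (hfin.prod hfin)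
    intro A _ B _ hAB
    exact Subcontinua.ext_of_sInf_sSup (Prod.ext_iff.1 hAB).1 (Prod.ext_iff.1 hAB).2
  · ext A
    refine (hiff A).trans ⟨fun ⟨hinf, hsup⟩ => ⟨_, _, hinf, hsup, ?_, A.eq_Icc_sInf_sSup⟩, ?_⟩
    · exact csInf_le_csSup A.1.nonempty A.1.isCompact.bddBelow A.1.isCompact.bddAbove
    · rintro ⟨a, b, ha, hb, hab, hA⟩
      rw [hA, csInf_Icc hab, csSup_Icc hab]
      exact ⟨ha, hb⟩
end
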